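/- Let V, q_max, A_max be nonnegative real numbers. Let Q, r, A : ℕ → ℝ and O : ℕ → ℝ be sequences such that Q(0) = 0, and for every t: Q(t+1) = max(Q(t) − r(t), 0) + O(t)·A(t), with r(t) ≥ 0, 0 ≤ A(t) ≤ A_max, O(t) ∈ {0,1}, and O(t) = 0 whenever Q(t) > V·q_max. Then for every t, Q(t) ≤ V·q_max + A_max. -/

import Mathlib

/-- Theorem 1(a), queue-length bound for the PMC policy. -/
theorem pmc_queue_bound (V qmax Amax : ℝ) (hV : 0 ≤ V) (hq : 0 ≤ qmax) (hA : 0 ≤ Amax)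
    (Q r A O : ℕ → ℝ) (hQ0 : Q 0 = 0)
    (hrec : ∀ t, Q (t + 1) = max (Q t - r t) 0 + O t * A t)
    (hr : ∀ t, 0 ≤ r t) (hAb : ∀ t, 0 ≤ A t ∧ A t ≤ Amax)
    (hO : ∀ t, O t = 0 ∨ O t = 1)
    (hctl : ∀ t, Q t > V * qmax → O t = 0) :
    ∀ t, Q t ≤ V * qmax + Amax := by
  have hVq : 0 ≤ V * qmax := mul_nonneg hV hq
  intro t
  induction t with
  | zero => rw [hQ0]; exact add_nonneg hVq hA
  | succ t ih =>
    rw [hrec]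
    have hserve : ∀ b, 0 ≤ b → Q t ≤ b → max (Q t - r t) 0 ≤ b := fun b hb hQ =>
      max_le (by linarith [hr t]) hb
    rcases le_or_gt (Q t) (V * qmax) with hle | hgt
    · have harr : O t * A t ≤ Amax := by
        rcases hO t with h | h
        · simpa [h] using hA
        · simpa [h] using (hAb t).2
      exact add_le_add (hserve _ hVq hle) harr
    · rw [hctl t hgt, zero_mul, add_zero]
      exact hserve _ (add_nonneg hVq hA) ih
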